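/- Let h ∈ G be a contracting element. Then ⟨h⟩ acts on the horofunction compactification Ȳ with North–South dynamics relative to [h⁺] and [h⁻]: for any open sets U ⊇ [h⁺] and V ⊇ [h⁻] in Ȳ there exists an integer n > 0 such that hⁿ(Ȳ \ V) ⊆ U and h⁻ⁿ(Ȳ \ U) ⊆ V. -/

import Mathlib

open Metric Filter Topology Set MeasureTheory Pointwise

noncomputable section

namespace ConfDyn

/-- `γ` is (the image of) a geodesic segment from `x` to `y`. -/
def IsGeodesicIn (Y : Type*) [MetricSpace Y] (γ : Set Y) (x y : Y) : Prop :=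
  ∃ f : ℝ → Y, f 0 = x ∧ f (dist x y) = y ∧
    (∀ s ∈ Set.Icc (0 : ℝ) (dist x y), ∀ t ∈ Set.Icc (0 : ℝ) (dist x y),
      dist (f s) (f t) = |s - t|) ∧
    γ = f '' Set.Icc (0 : ℝ) (dist x y)

/-- `Y` is a geodesic metric space. -/
def GeodesicSpace (Y : Type*) [MetricSpace Y] : Prop :=
  ∀ x y : Y, ∃ γ : Set Y, IsGeodesicIn Y γ x y

/-- the shortest projection of the point `y` to the subset `X`. -/
def projSet {Y : Type*} [MetricSpace Y] (X : Set Y) (y : Y) : Set Y :=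
  {x ∈ X | dist y x = Metric.infDist y X}

/-- the shortest projection of the subset `A` to the subset `X`. -/
def projSetOf {Y : Type*} [MetricSpace Y] (X A : Set Y) : Set Y :=
  ⋃ a ∈ A, projSet X a

/-- `d_X(x,y)`, the diameter of `π_X(x) ∪ π_X(y)`. -/
def projDist {Y : Type*} [MetricSpace Y] (X : Set Y) (x y : Y) : ENNReal :=
  EMetric.diam (projSet X x ∪ projSet X y)

/-- `X` is a `C`-contracting subset: any geodesic segment at distance at least `C`
from `X` has shortest projection to `X` of diameter at most `C`. -/
def IsContractingSet {Y : Type*} [MetricSpace Y] (C : ℝ) (X : Set Y) : Prop :=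
  ∀ x y : Y, ∀ γ : Set Y, IsGeodesicIn Y γ x y →
    (∀ p ∈ γ, C ≤ Metric.infDist p X) →
    EMetric.diam (projSetOf X γ) ≤ ENNReal.ofReal C

/-- the Busemann function based at `o` associated to `y`, `b_y(x) = d(x,y) - d(o,y)`. -/
def busemannCM {Y : Type*} [MetricSpace Y] (o y : Y) : C(Y, ℝ) :=
  ⟨fun x => dist x y - dist o y,
    (continuous_id.dist continuous_const).sub continuous_const⟩

/-- the horofunction compactification of `Y`: the closure of `{b_y : y ∈ Y}` in
`C(Y,ℝ)` with the compact-open topology. -/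
def horoCpt (Y : Type*) [MetricSpace Y] (o : Y) : Set C(Y, ℝ) :=
  closure (Set.range (busemannCM o))

/-- `ξ` is a point of the horofunction boundary `∂_h Y`. -/
def IsHoroPoint {Y : Type*} [MetricSpace Y] (o : Y) (ξ : C(Y, ℝ)) : Prop :=
  ξ ∈ horoCpt Y o ∧ ∀ y : Y, ξ ≠ busemannCM o y

/-- a sequence of points of `Y` converges to `ξ` in the horofunction compactification. -/
def HoroConv {Y : Type*} [MetricSpace Y] (o : Y) (u : ℕ → Y) (ξ : C(Y, ℝ)) : Prop :=
  Filter.Tendsto (fun n => busemannCM o (u n)) atTop (nhds ξ)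

/-- two horofunctions have (K-)finite difference for some K. -/
def FinDiff {Y : Type*} [MetricSpace Y] (ξ η : C(Y, ℝ)) : Prop :=
  ∃ K : ℝ, ∀ z : Y, |ξ z - η z| ≤ K

/-- the locus of a subset of the horofunction boundary. -/
def locus {Y : Type*} [MetricSpace Y] (o : Y) (Λ : Set C(Y, ℝ)) : Set C(Y, ℝ) :=
  {η | IsHoroPoint o η ∧ ∃ ξ ∈ Λ, FinDiff ξ η}

/-- the finite-difference relation as a setoid on `C(Y,ℝ)`. -/
def finDiffSetoid (Y : Type*) [MetricSpace Y] : Setoid C(Y, ℝ) where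
  r := FinDiff
  iseqv := ⟨fun ξ => ⟨0, fun z => by simp⟩,
    fun h => h.imp (fun K hK z => by rw [abs_sub_comm]; exact hK z),
    fun h₁ h₂ => by
      obtain ⟨K₁, hK₁⟩ := h₁
      obtain ⟨K₂, hK₂⟩ := h₂
      exact ⟨K₁ + K₂, fun z => (abs_sub_le _ _ _).trans (add_le_add (hK₁ z) (hK₂ z))⟩⟩

/-- the limit set of a subset `X ⊆ Y` in the horofunction boundary. -/
def limitSetOf {Y : Type*} [MetricSpace Y] (o : Y) (X : Set Y) : Set C(Y, ℝ) :=
  {ξ | IsHoroPoint o ξ ∧ ∃ u : ℕ → Y, (∀ n, u n ∈ X) ∧ HoroConv o u ξ}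

/-- accumulation points of a sequence of points of `Y` in the horofunction boundary. -/
def accPoints {Y : Type*} [MetricSpace Y] (o : Y) (u : ℕ → Y) : Set C(Y, ℝ) :=
  {ξ | IsHoroPoint o ξ ∧ ∃ φ : ℕ → ℕ, StrictMono φ ∧ HoroConv o (u ∘ φ) ξ}

/-- `X` is a quasi-geodesic: the image of a quasi-isometric embedding of a real interval. -/
def IsQuasiGeodesicSet {Y : Type*} [MetricSpace Y] (X : Set Y) : Prop :=
  ∃ (c : ℝ) (I : Set ℝ) (φ : ℝ → Y), 1 ≤ c ∧ I.OrdConnected ∧ X = φ '' I ∧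
    ∀ s ∈ I, ∀ t ∈ I,
      (1 / c) * |s - t| - c ≤ dist (φ s) (φ t) ∧ dist (φ s) (φ t) ≤ c * |s - t| + c

section GroupAction

variable {Y : Type*} [MetricSpace Y] {G : Type*} [Group G] [MulAction G Y]

/-- `G` acts by isometries on `Y`. -/
def IsometricAction (G Y : Type*) [Group G] [MulAction G Y] [MetricSpace Y] : Prop :=
  ∀ g : G, Isometry (fun y : Y => g • y)

/-- the action of `G` on `Y` is (metrically) proper. -/
def ProperAction (G Y : Type*) [Group G] [MulAction G Y] [MetricSpace Y] : Prop :=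
  ∀ B : Set Y, Bornology.IsBounded B → Set.Finite {g : G | (g • B) ∩ B ≠ ∅}

/-- `G` is non-elementary: no finite-index subgroup is trivial or infinite cyclic. -/
def NonElementary (G : Type*) [Group G] : Prop :=
  ∀ H : Subgroup G, H.index ≠ 0 → ∀ g : G, H ≠ Subgroup.zpowers g

/-- the orbit of `o` under the cyclic group generated by `f`. -/
def cyclicOrbit (o : Y) (f : G) : Set Y :=
  {y : Y | ∃ n : ℤ, y = f ^ n • o}

/-- `f` is a contracting element with `C`-contracting orbit: it has infinite order,
`n ↦ fⁿ • o` is a quasi-isometric embedding of `ℤ`, and `⟨f⟩ • o` is `C`-contracting. -/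
def IsContractingElt (o : Y) (C : ℝ) (f : G) : Prop :=
  (∀ n : ℤ, n ≠ 0 → f ^ n ≠ 1) ∧
  (∃ c : ℝ, 1 ≤ c ∧ ∀ m n : ℤ,
      (1 / c) * |(m : ℝ) - (n : ℝ)| - c ≤ dist (f ^ m • o) (f ^ n • o) ∧
      dist (f ^ m • o) (f ^ n • o) ≤ c * |(m : ℝ) - (n : ℝ)| + c) ∧
  IsContractingSet C (cyclicOrbit o f)

/-- `f` is a contracting element. -/
def IsContractingEltAny (o : Y) (f : G) : Prop :=
  ∃ C : ℝ, 1 ≤ C ∧ IsContractingElt o C f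

/-- the elementary group `E(f)`: elements moving `⟨f⟩ • o` a finite Hausdorff distance. -/
def EGroup (o : Y) (f : G) : Set G :=
  {g : G | EMetric.hausdorffEdist (g • cyclicOrbit o f) (cyclicOrbit o f) ≠ ⊤}

/-- the axis `Ax(f) = E(f) • o`. -/
def axisOf (o : Y) (f : G) : Set Y :=
  (fun g : G => g • o) '' EGroup o f

/-- the family of all `G`-translated axes of `h` and `k`. -/
def axesPairFam (o : Y) (h k : G) : Set (Set Y) :=
  {S | ∃ g : G, S = g • axisOf o h ∨ S = g • axisOf o k}

/-- `h` and `k` are independent contracting elements: the family of their translated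
axes has bounded projection. -/
def IndepElts (o : Y) (h k : G) : Prop :=
  ∃ B : ℝ, 0 < B ∧ ∀ U ∈ axesPairFam o h k, ∀ V ∈ axesPairFam o h k,
    U ≠ V → EMetric.diam (projSetOf U V) ≤ ENNReal.ofReal B

/-- the family of all `G`-translated axes of the triple `f₁, f₂, f₃`. -/
def axesTripleFam (o : Y) (f₁ f₂ f₃ : G) : Set (Set Y) :=
  {S | ∃ g : G, S = g • axisOf o f₁ ∨ S = g • axisOf o f₂ ∨ S = g • axisOf o f₃}

/-- `F = {f₁,f₂,f₃}` is an admissible triple with constants `C`, `B₀`: three pairwise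
independent contracting elements whose translated axes are `C`-contracting with
`B₀`-bounded projection. -/
def IsAdmissibleTriple (o : Y) (C B₀ : ℝ) (f₁ f₂ f₃ : G) : Prop :=
  f₁ ≠ f₂ ∧ f₁ ≠ f₃ ∧ f₂ ≠ f₃ ∧
  IsContractingEltAny o f₁ ∧ IsContractingEltAny o f₂ ∧ IsContractingEltAny o f₃ ∧
  IndepElts o f₁ f₂ ∧ IndepElts o f₁ f₃ ∧ IndepElts o f₂ f₃ ∧
  (∀ S ∈ axesTripleFam o f₁ f₂ f₃, IsContractingSet C S) ∧
  (∀ U ∈ axesTripleFam o f₁ f₂ f₃, ∀ V ∈ axesTripleFam o f₁ f₂ f₃,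
    U ≠ V → EMetric.diam (projSetOf U V) ≤ ENNReal.ofReal B₀)

/-- the geodesic `γ` contains an `(r,f)`-barrier at `g • o`. -/
def HasBarrier (o : Y) (r : ℝ) (f g : G) (γ : Set Y) : Prop :=
  Metric.infDist (g • o) γ ≤ r ∧ Metric.infDist ((g * f) • o) γ ≤ r

/-- the partial cone `Ω_x^F(g • o, r)`. -/
def partialCone (o x : Y) (f₁ f₂ f₃ : G) (g : G) (r : ℝ) : Set Y :=
  {z | ∃ γ : Set Y, IsGeodesicIn Y γ x z ∧
      (HasBarrier o r f₁ g γ ∨ HasBarrier o r f₂ g γ ∨ HasBarrier o r f₃ g γ)}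

/-- the partial shadow `Π_x^F(g • o, r)`: accumulation points of the partial cone in
the horofunction boundary. -/
def partialShadow (o x : Y) (f₁ f₂ f₃ : G) (g : G) (r : ℝ) : Set C(Y, ℝ) :=
  {ξ | IsHoroPoint o ξ ∧ ∃ u : ℕ → Y, (∀ n, u n ∈ partialCone o x f₁ f₂ f₃ g r) ∧
      HoroConv o u ξ}

/-- `ξ` is an `(r,F)`-conical point. -/
def IsConicalPt (o : Y) (f₁ f₂ f₃ : G) (r : ℝ) (ξ : C(Y, ℝ)) : Prop :=
  ∃ g₀ : G, Set.Infinite {g : G | ξ ∈ partialShadow o (g₀ • o) f₁ f₂ f₃ g r}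

/-- the usual cone `Ω_x(y,r)`. -/
def usualCone (x y : Y) (r : ℝ) : Set Y :=
  {z | ∃ γ : Set Y, IsGeodesicIn Y γ x z ∧ ∃ p ∈ γ, dist p y ≤ r}

/-- the usual shadow `Π_x(y,r)`. -/
def usualShadow (o x y : Y) (r : ℝ) : Set C(Y, ℝ) :=
  {ξ | IsHoroPoint o ξ ∧ ∃ u : ℕ → Y, (∀ n, u n ∈ usualCone x y r) ∧ HoroConv o u ξ}

/-- the set `Λ_c(G)` of conical points of the action. -/
def conicalSet (G : Type*) {Y : Type*} [Group G] [MulAction G Y] [MetricSpace Y]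
    (o : Y) : Set C(Y, ℝ) :=
  {ξ | ∃ r : ℝ, 0 < r ∧ ∃ g₀ : G, ∃ u : ℕ → G,
      Filter.Tendsto (fun n => dist o (u n • o)) atTop atTop ∧
      ∀ n, ξ ∈ usualShadow o (g₀ • o) (u n • o) r}

/-- the attracting fixed-point set `[h⁺]`: the locus of the accumulation points of
`{hⁿ o : n > 0}` in the horofunction boundary. -/
def attrFix (o : Y) (h : G) : Set C(Y, ℝ) :=
  locus o (accPoints o (fun n : ℕ => h ^ (n + 1) • o))

/-- the repelling fixed-point set `[h⁻]`. -/
def repFix (o : Y) (h : G) : Set C(Y, ℝ) :=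
  locus o (accPoints o (fun n : ℕ => h ^ (-(n + 1) : ℤ) • o))

/-- the limit set `Λ G y` of the orbit `G • y` in the horofunction boundary. -/
def orbitLimitSet (G : Type*) {Y : Type*} [Group G] [MulAction G Y] [MetricSpace Y]
    (o y : Y) : Set C(Y, ℝ) :=
  {ξ | IsHoroPoint o ξ ∧ ∃ u : ℕ → G,
      Filter.Tendsto (fun n => busemannCM o (u n • y)) atTop (nhds ξ)}

/-- the action of an isometry `g` on horofunctions. -/
def horoAct [ContinuousConstSMul G Y] (o : Y) (g : G) (ξ : C(Y, ℝ)) : C(Y, ℝ) :=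
  ⟨fun y => ξ (g⁻¹ • y) - ξ (g⁻¹ • o),
    (ξ.continuous.comp (continuous_const_smul g⁻¹)).sub continuous_const⟩

/-- the number of orbit points of `Γ ⊆ G` in the closed ball of radius `R` around `o`. -/
def orbitCount (G : Type*) {Y : Type*} [Group G] [MulAction G Y] [MetricSpace Y]
    (o : Y) (Γ : Set G) (R : ℝ) : ℕ :=
  Nat.card {g : G // g ∈ Γ ∧ dist o (g • o) ≤ R}

/-- the critical exponent `ω_Γ` of a subset `Γ ⊆ G`. -/
def critExp (G : Type*) {Y : Type*} [Group G] [MulAction G Y] [MetricSpace Y]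
    (o : Y) (Γ : Set G) : ℝ :=
  Filter.limsup (fun R : ℝ => Real.log (orbitCount G o Γ R) / R) atTop

/-- an `ω`-dimensional `G`-equivariant conformal density on the horofunction boundary:
a family of finite measures supported on `∂_h Y`, normalized at `o`, `G`-equivariant,
with conformal derivative `dμ_x/dμ_y(ξ) = e^{-ω·B_ξ(x,y)}`. -/
def IsConformalDensity (G : Type*) {Y : Type*} [Group G] [MulAction G Y] [MetricSpace Y]
    [ContinuousConstSMul G Y] [MeasurableSpace C(Y, ℝ)]
    (o : Y) (ω : ℝ) (μ : Y → MeasureTheory.Measure C(Y, ℝ)) : Prop :=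
  (∀ x : Y, MeasureTheory.IsFiniteMeasure (μ x)) ∧
  (∀ x : Y, μ x {ξ : C(Y, ℝ) | ¬ IsHoroPoint o ξ} = 0) ∧
  μ o Set.univ = 1 ∧
  (∀ g : G, ∀ x : Y, MeasureTheory.Measure.map (horoAct o g) (μ x) = μ (g • x)) ∧
  (∀ x y : Y, μ x = (μ y).withDensity
      (fun ξ : C(Y, ℝ) => ENNReal.ofReal (Real.exp (-ω * (ξ x - ξ y)))))

end GroupAction

theorem cyclicOrbit_inv {Y G : Type*} [Group G] [MulAction G Y] (o : Y) (h : G) :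
    cyclicOrbit o h⁻¹ = cyclicOrbit o h := by
  ext y
  constructor
  · rintro ⟨n, rfl⟩
    exact ⟨-n, by simp⟩
  · rintro ⟨n, rfl⟩
    exact ⟨-n, by simp⟩

section NorthSouth

variable {Y : Type*} [MetricSpace Y] {G : Type*} [Group G] [MulAction G Y]

theorem IsContractingSet.dist_le_of_forall_le_infDist {C : ℝ} (hC : 0 ≤ C) {X : Set Y}
    (hX : IsContractingSet C X) {a b p q : Y} {γ : Set Y} (hγ : IsGeodesicIn Y γ a b)
    (hfar : ∀ z ∈ γ, C ≤ Metric.infDist z X) (hp : p ∈ projSet X a) (hq : q ∈ projSet X b) :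
    dist p q ≤ C := by
  have hdiam := hX a b γ hγ hfar
  obtain ⟨f, hf0, hf1, -, rfl⟩ := hγ
  have ha : a ∈ f '' Icc 0 (dist a b) := ⟨0, ⟨le_rfl, dist_nonneg⟩, hf0⟩
  have hb : b ∈ f '' Icc 0 (dist a b) := ⟨_, ⟨dist_nonneg, le_rfl⟩, hf1⟩
  have h2 : edist p q ≤ ENNReal.ofReal C :=
    (Metric.edist_le_ediam_of_mem (mem_biUnion ha hp) (mem_biUnion hb hq)).trans hdiam
  rwa [edist_dist, ENNReal.ofReal_le_ofReal_iff hC] at h2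

/-- If two points have shortest projections to a contracting set far apart, then a geodesic
between them passes near the projection points, whence a reverse triangle inequality. -/
theorem IsContractingSet.dist_add_dist_le (hY : GeodesicSpace Y) {C : ℝ} (hC : 0 ≤ C)
    {X : Set Y} (hX : IsContractingSet C X) (hproj : ∀ y, (projSet X y).Nonempty)
    {x y p q : Y} (hp : p ∈ projSet X x) (hq : q ∈ projSet X y) (hpq : C < dist p q) :
    dist x q + dist q y ≤ dist x y + (4 * C + 2) := by
  obtain ⟨γ, hγ⟩ := hY x y
  have hγ' := hγ
  obtain ⟨f, hf0, hf1, hf, rfl⟩ := hγ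
  set L := dist x y with hL
  have hL0 : 0 ≤ L := dist_nonneg
  by_cases hyC : Metric.infDist y X ≤ C
  · have h1 : dist y q ≤ C := hq.2.trans_le hyC
    have h2 := dist_triangle x y q
    rw [dist_comm q y]
    linarith
  push Not at hyC
  have hcont : ContinuousOn f (Icc 0 L) := by
    refine (LipschitzOnWith.of_dist_le_mul (K := 1) fun s hs t ht => ?_).continuousOn
    rw [hf s hs t ht, Real.dist_eq, NNReal.coe_one, one_mul]
  have hScl : IsCompact (Icc 0 L ∩ (fun t => Metric.infDist (f t) X) ⁻¹' Iic C) :=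
    isCompact_Icc.of_isClosed_subset
      (((Metric.continuous_infDist_pt X).comp_continuousOn hcont).preimage_isClosed_of_isClosed
        isClosed_Icc isClosed_Iic) inter_subset_left
  have hSne : (Icc 0 L ∩ (fun t => Metric.infDist (f t) X) ⁻¹' Iic C).Nonempty := by
    by_contra hempty
    refine hpq.not_ge (hX.dist_le_of_forall_le_infDist hC hγ' ?_ hp hq)
    rintro _ ⟨t, ht, rfl⟩
    by_contra! hlt
    exact hempty ⟨t, ht, hlt.le⟩
  obtain ⟨t₀, ⟨ht₀, ht₀C⟩, hmax⟩ := hScl.exists_isGreatest hSne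
  have ht₀L : t₀ < L := by
    refine lt_of_le_of_ne ht₀.2 ?_
    intro heq
    have : Metric.infDist (f t₀) X ≤ C := ht₀C
    rw [heq, hf1] at this
    exact this.not_gt hyC
  obtain ⟨s, hts, hs1, hsL⟩ : ∃ s, t₀ < s ∧ s ≤ t₀ + 1 ∧ s ≤ L :=
    ⟨min (t₀ + 1) L, lt_min (by linarith) ht₀L, min_le_left _ _, min_le_right _ _⟩
  have hs : s ∈ Icc 0 L := ⟨by linarith [ht₀.1], hsL⟩
  have hsy : dist (f s) y = L - s := by
    rw [← hf1, hf s hs L ⟨hL0, le_rfl⟩, abs_sub_comm, abs_of_nonneg (by linarith)]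
  have hxs : dist x (f s) = s := by
    rw [← hf0, hf 0 ⟨le_rfl, hL0⟩ s hs, zero_sub, abs_neg, abs_of_nonneg hs.1]
  obtain ⟨r, hr⟩ := hproj (f s)
  have hrq : dist r q ≤ C := by
    refine hX.dist_le_of_forall_le_infDist hC (a := f s) (b := y)
      (γ := (fun t => f (s + t)) '' Icc 0 (dist (f s) y))
      ⟨fun t => f (s + t), by simp, by simp [hsy, hf1], ?_, rfl⟩ ?_ hr hq
    · rw [hsy]
      intro a ha b hb
      rw [hf _ ⟨by linarith [ha.1, hs.1], by linarith [ha.2]⟩ _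
        ⟨by linarith [hb.1, hs.1], by linarith [hb.2]⟩, add_sub_add_left_eq_sub]
    · rw [hsy]
      rintro _ ⟨t, ht, rfl⟩
      by_contra! hlt
      have := hmax ⟨⟨by linarith [ht.1, hs.1], by linarith [ht.2]⟩, hlt.le⟩
      linarith [ht.1]
  have hfr : dist (f s) r ≤ C + 1 := by
    rw [hr.2]
    have h1 : Metric.infDist (f s) X ≤ Metric.infDist (f t₀) X + dist (f s) (f t₀) :=
      Metric.infDist_le_infDist_add_dist
    have h2 : Metric.infDist (f t₀) X ≤ C := ht₀C
    rw [hf s hs t₀ ht₀, abs_of_pos (by linarith)] at h1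
    linarith
  have h1 := dist_triangle (f s) r q
  have h2 := dist_triangle x (f s) q
  have h3 := dist_triangle_left q y (f s)
  linarith

theorem horoAct_busemannCM [ContinuousConstSMul G Y] (hiso : IsometricAction G Y) (o : Y)
    (g : G) (y : Y) : horoAct o g (busemannCM o y) = busemannCM o (g • y) := by
  have key : ∀ x, dist (g⁻¹ • x) y = dist x (g • y) := fun x => by
    simpa using ((hiso g).dist_eq (g⁻¹ • x) y).symm
  ext x
  change dist (g⁻¹ • x) y - dist o y - (dist (g⁻¹ • o) y - dist o y) =
    dist x (g • y) - dist o (g • y)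
  rw [key, key]
  ring

theorem continuous_horoAct [ContinuousConstSMul G Y] (o : Y) (g : G) :
    Continuous (horoAct (Y := Y) o g) := by
  have : horoAct (Y := Y) o g = fun ξ : C(Y, ℝ) =>
      ξ.comp ⟨fun y => g⁻¹ • y, continuous_const_smul g⁻¹⟩ -
        ContinuousMap.const Y (ξ (g⁻¹ • o)) := by
    ext ξ x
    rfl
  rw [this]
  exact (ContinuousMap.continuous_precomp _).sub
    (ContinuousMap.continuous_const'.comp (continuous_eval_const _))

theorem horoAct_mem_horoCpt [ContinuousConstSMul G Y] (hiso : IsometricAction G Y) (o : Y)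
    (g : G) {ξ : C(Y, ℝ)} (hξ : ξ ∈ horoCpt Y o) : horoAct o g ξ ∈ horoCpt Y o := by
  refine map_mem_closure (continuous_horoAct o g) hξ ?_
  rintro _ ⟨y, rfl⟩
  exact ⟨g • y, (horoAct_busemannCM hiso o g y).symm⟩

theorem isCompact_horoCpt (o : Y) : IsCompact (horoCpt Y o) := by
  let P : Set (Y → ℝ) := {f | f o = 0 ∧ ∀ x y, |f x - f y| ≤ dist x y}
  have hPclosed : IsClosed P := by
    have : P = {f | f o = 0} ∩ ⋂ x, ⋂ y, {f : Y → ℝ | |f x - f y| ≤ dist x y} := by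
      ext f
      simp [P]
    rw [this]
    exact (isClosed_eq (continuous_apply o) continuous_const).inter
      (isClosed_iInter fun x => isClosed_iInter fun y =>
        isClosed_le ((continuous_apply x).sub (continuous_apply y)).abs continuous_const)
  have hPcompact : IsCompact P := by
    refine (isCompact_univ_pi fun x : Y =>
      isCompact_Icc (a := -dist x o) (b := dist x o)).of_isClosed_subset hPclosed ?_
    rintro f ⟨hfo, hf⟩ x -
    exact abs_le.1 (by simpa [hfo] using hf x o)
  have hlip : ∀ f ∈ P, LipschitzWith 1 f := fun f hf =>
    LipschitzWith.of_dist_le_mul fun x y => by simpa [Real.dist_eq] using hf.2 x y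
  have hS : IsCompact {ξ : C(Y, ℝ) | (ξ : Y → ℝ) ∈ P} := by
    refine ArzelaAscoli.isCompact_of_equicontinuous _ ?_ ?_
    · convert hPcompact
      ext f
      exact ⟨fun ⟨ξ, hξ, h⟩ => h ▸ hξ, fun hf => ⟨⟨f, (hlip f hf).continuous⟩, hf, rfl⟩⟩
    · exact (LipschitzWith.uniformEquicontinuous _ 1 fun ξ => hlip _ ξ.2).equicontinuous
  refine hS.of_isClosed_subset isClosed_closure (closure_minimal ?_ ?_)
  · rintro _ ⟨y, rfl⟩
    refine ⟨sub_self _, fun x z => ?_⟩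
    change |dist x y - dist o y - (dist z y - dist o y)| ≤ dist x z
    rw [sub_sub_sub_cancel_right]
    exact abs_dist_sub_le x z y
  · exact hPclosed.preimage (continuous_pi fun x => continuous_eval_const x)

theorem isHoroPoint_of_tendsto [ProperSpace Y] (hY : GeodesicSpace Y) {o : Y} {u : ℕ → Y}
    {ξ : C(Y, ℝ)} (hu : Tendsto (fun n => dist o (u n)) atTop atTop) (hξ : HoroConv o u ξ) :
    IsHoroPoint o ξ := by
  refine ⟨mem_closure_of_tendsto hξ (Eventually.of_forall fun n => ⟨u n, rfl⟩), ?_⟩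
  rintro y rfl
  have hunif := ContinuousMap.tendsto_iff_forall_isCompact_tendstoUniformlyOn.1 hξ _
    (isCompact_closedBall o (dist o y + 1))
  have hunif' := Metric.tendstoUniformlyOn_iff.1 hunif 1 one_pos
  obtain ⟨n, hn, hn'⟩ := (hunif'.and (hu.eventually_ge_atTop (dist o y + 1))).exists
  obtain ⟨-, f, hf0, hf1, hf, -⟩ := hY o (u n)
  have hoy : 0 ≤ dist o y := dist_nonneg
  have hR : dist o y + 1 ∈ Icc 0 (dist o (u n)) := ⟨by linarith, hn'⟩
  have h0 : dist o (f (dist o y + 1)) = dist o y + 1 := by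
    rw [← hf0, hf 0 ⟨le_rfl, dist_nonneg⟩ _ (by rwa [hf0]), hf0, zero_sub, abs_neg,
      abs_of_nonneg hR.1]
  have h1 : dist (f (dist o y + 1)) (u n) = dist o (u n) - (dist o y + 1) := by
    nth_rewrite 1 [← hf1]
    rw [hf _ hR _ ⟨dist_nonneg, le_rfl⟩, abs_sub_comm, abs_of_nonneg (by linarith)]
  have h2 := hn (f (dist o y + 1)) (by rw [mem_closedBall, dist_comm, h0])
  rw [Real.dist_eq] at h2
  have h3 := (abs_lt.1 h2).2
  change dist (f (dist o y + 1)) y - dist o y -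
    (dist (f (dist o y + 1)) (u n) - dist o (u n)) < 1 at h3
  have h4 : 0 ≤ dist (f (dist o y + 1)) y := dist_nonneg
  linarith

theorem IsContractingElt.inv {o : Y} {C : ℝ} {h : G} (hh : IsContractingElt o C h) :
    IsContractingElt o C h⁻¹ := by
  obtain ⟨h1, ⟨c, hc, h2⟩, h3⟩ := hh
  refine ⟨fun n hn => ?_, ⟨c, hc, fun m n => ?_⟩, by rwa [cyclicOrbit_inv]⟩
  · rw [inv_zpow']
    exact h1 _ (neg_ne_zero.2 hn)
  · have := h2 (-m) (-n)
    rw [inv_zpow', inv_zpow']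
    push_cast at this
    rwa [neg_sub_neg, abs_sub_comm] at this

theorem IsContractingElt.tendsto_dist {ι : Type*} {l : Filter ι} {o : Y} {C : ℝ} {h : G}
    (hh : IsContractingElt o C h) {m : ι → ℤ} (hm : Tendsto (fun i => |m i|) l atTop) (y : Y) :
    Tendsto (fun i => dist y (h ^ m i • o)) l atTop := by
  obtain ⟨-, ⟨c, hc, hqi⟩, -⟩ := hh
  have hc0 : 0 < 1 / c := by positivity
  have h1 : Tendsto (fun i => (1 / c) * ((|m i| : ℤ) : ℝ) + (-c - dist y o)) l atTop :=
    tendsto_atTop_add_const_right _ _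
      ((tendsto_intCast_atTop_atTop.comp hm).const_mul_atTop hc0)
  refine tendsto_atTop_mono (fun i => ?_) h1
  have h2 := (hqi (m i) 0).1
  have h3 := dist_triangle_left (h ^ m i • o) o y
  simp only [Int.cast_zero, sub_zero, zpow_zero, one_smul] at h2
  push_cast
  linarith

theorem mem_projSet_iff {X : Set Y} {y x : Y} :
    x ∈ projSet X y ↔ x ∈ X ∧ ∀ z ∈ X, dist y x ≤ dist y z := by
  refine and_congr_right fun hx => ⟨fun h z hz => h ▸ Metric.infDist_le_dist_of_mem hz,
    fun h => le_antisymm ((Metric.le_infDist ⟨x, hx⟩).2 fun {z} hz => h z hz)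
      (Metric.infDist_le_dist_of_mem hx)⟩

theorem IsContractingElt.projSet_nonempty {o : Y} {C : ℝ} {h : G}
    (hh : IsContractingElt o C h) (y : Y) : ∃ m : ℤ, h ^ m • o ∈ projSet (cyclicOrbit o h) y := by
  have habs : Tendsto (fun m : ℤ => |m|) cofinite atTop := by
    rw [Int.cofinite_eq]
    exact tendsto_abs_atBot_atTop.sup tendsto_abs_atTop_atTop
  obtain ⟨m, hm⟩ := (hh.tendsto_dist habs y).exists_forall_le
  refine ⟨m, mem_projSet_iff.2 ⟨⟨m, rfl⟩, ?_⟩⟩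
  rintro _ ⟨j, rfl⟩
  exact hm j

theorem zpow_add_smul_mem_projSet (hiso : IsometricAction G Y) {o y : Y} {h : G} {m : ℤ}
    (hm : h ^ m • o ∈ projSet (cyclicOrbit o h) y) (n : ℤ) :
    h ^ (n + m) • o ∈ projSet (cyclicOrbit o h) (h ^ n • y) := by
  refine mem_projSet_iff.2 ⟨⟨_, rfl⟩, ?_⟩
  rintro _ ⟨j, rfl⟩
  have := (mem_projSet_iff.1 hm).2 _ ⟨j - n, rfl⟩
  rw [← (hiso (h ^ n)).dist_eq, ← (hiso (h ^ n)).dist_eq y, smul_smul, smul_smul, ← zpow_add,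
    ← zpow_add, add_sub_cancel] at this
  exact this

theorem repFix_eq_attrFix_inv (o : Y) (h : G) : repFix o h = attrFix o h⁻¹ := by
  unfold repFix attrFix
  congr 2
  ext n
  rw [zpow_neg, inv_pow]
  norm_cast

/-- A limit of points whose projections to the axis escape in the positive direction belongs to
the attracting fixed-point set. -/
theorem IsContractingElt.mem_attrFix [ProperSpace Y] (hY : GeodesicSpace Y) {o : Y} {C : ℝ}
    (hC : 0 ≤ C) {h : G} (hh : IsContractingElt o C h) {y : ℕ → Y} {m : ℕ → ℤ}
    (hm : ∀ k, h ^ m k • o ∈ projSet (cyclicOrbit o h) (y k)) (hm' : Tendsto m atTop atTop)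
    {ξ : C(Y, ℝ)} (hξ : HoroConv o y ξ) : ξ ∈ attrFix o h := by
  have hproj : ∀ z, (projSet (cyclicOrbit o h) z).Nonempty := fun z =>
    let ⟨i, hi⟩ := hh.projSet_nonempty z
    ⟨_, hi⟩
  have hdist : ∀ z, Tendsto (fun k => dist z (h ^ m k • o)) atTop atTop :=
    hh.tendsto_dist (tendsto_abs_atTop_atTop.comp hm')
  have hnear : ∀ x, ∀ᶠ k in atTop, dist x (h ^ m k • o) + dist (h ^ m k • o) (y k) ≤
      dist x (y k) + (4 * C + 2) := by
    intro x
    obtain ⟨p, hp⟩ := hproj x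
    filter_upwards [(hdist p).eventually_gt_atTop C] with k hk
    exact hh.2.2.dist_add_dist_le hY hC hproj hp (hm k) hk
  have hy : Tendsto (fun k => dist o (y k)) atTop atTop := by
    refine tendsto_atTop_mono' _ ?_ (tendsto_atTop_add_const_right _ (-(4 * C + 2)) (hdist o))
    filter_upwards [hnear o] with k hk
    have : 0 ≤ dist (h ^ m k • o) (y k) := dist_nonneg
    linarith
  let n : ℕ → ℕ := fun k => (m k - 1).toNat
  have hn : ∀ᶠ k in atTop, ((n k + 1 : ℕ) : ℤ) = m k := by
    filter_upwards [hm'.eventually_ge_atTop 1] with k hk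
    simp only [n]
    omega
  have hn' : Tendsto n atTop atTop := by
    refine tendsto_atTop.2 fun b => ?_
    filter_upwards [hm'.eventually_ge_atTop (b + 1)] with k hk
    simp only [n]
    omega
  obtain ⟨φ, hφ, hnφ⟩ := strictMono_subseq_of_tendsto_atTop hn'
  obtain ⟨η, -, ψ, hψ, hη⟩ := (isCompact_horoCpt o).tendsto_subseq
    (x := fun k => busemannCM o (h ^ (n (φ k) + 1) • o))
    (fun k => subset_closure ⟨_, rfl⟩)
  have hφψ : Tendsto (φ ∘ ψ) atTop atTop := hφ.tendsto_atTop.comp hψ.tendsto_atTop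
  have hpow : ∀ᶠ k in atTop, h ^ (n (φ (ψ k)) + 1) • o = h ^ m (φ (ψ k)) • o := by
    filter_upwards [hφψ.eventually hn] with k hk
    change ((n (φ (ψ k)) + 1 : ℕ) : ℤ) = m (φ (ψ k)) at hk
    rw [← hk, zpow_natCast]
  have hηconv : HoroConv o ((fun n : ℕ => h ^ (n + 1) • o) ∘ (n ∘ φ ∘ ψ)) η := hη
  have hηpt : IsHoroPoint o η := by
    refine isHoroPoint_of_tendsto hY (((hdist o).comp hφψ).congr' ?_) hηconv
    filter_upwards [hpow] with k hk
    exact congrArg (dist o) hk.symm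
  refine ⟨isHoroPoint_of_tendsto hY hy hξ, η, ⟨hηpt, _, hnφ.comp hψ, hηconv⟩, 4 * C + 2,
    fun z => ?_⟩
  have heval : ∀ {u : ℕ → Y} {ζ : C(Y, ℝ)}, HoroConv o u ζ →
      Tendsto (fun k => dist z (u k) - dist o (u k)) atTop (𝓝 (ζ z)) := fun hζ =>
    ((continuous_eval_const z).tendsto _).comp hζ
  refine le_of_tendsto (((heval hηconv).sub ((heval hξ).comp hφψ)).abs) ?_
  filter_upwards [hpow, hφψ.eventually (hnear z), hφψ.eventually (hnear o)] with k h1 h2 h3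
  simp only [Function.comp_apply] at h2 h3 ⊢
  rw [h1, abs_le]
  have h4 := dist_triangle z (h ^ m (φ (ψ k)) • o) (y (φ (ψ k)))
  have h5 := dist_triangle o (h ^ m (φ (ψ k)) • o) (y (φ (ψ k)))
  constructor <;> linarith

/-- A limit of points whose projections to the axis escape in the negative direction belongs to
the repelling fixed-point set. -/
theorem IsContractingElt.mem_repFix [ProperSpace Y] (hY : GeodesicSpace Y) {o : Y} {C : ℝ}
    (hC : 0 ≤ C) {h : G} (hh : IsContractingElt o C h) {y : ℕ → Y} {m : ℕ → ℤ}
    (hm : ∀ k, h ^ m k • o ∈ projSet (cyclicOrbit o h) (y k)) (hm' : Tendsto m atTop atBot)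
    {ξ : C(Y, ℝ)} (hξ : HoroConv o y ξ) : ξ ∈ repFix o h := by
  rw [repFix_eq_attrFix_inv]
  refine hh.inv.mem_attrFix hY hC (m := fun k => -m k) (fun k => ?_)
    (tendsto_neg_atBot_atTop.comp hm') hξ
  rw [cyclicOrbit_inv, inv_zpow', neg_neg]
  exact hm k

/-- One half of North–South dynamics, for all large powers. -/
theorem IsContractingElt.eventually_horoAct_mem [ProperSpace Y] [ContinuousConstSMul G Y]
    (hY : GeodesicSpace Y) (hiso : IsometricAction G Y) {o : Y} {C : ℝ} (hC : 0 ≤ C) {h : G}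
    (hh : IsContractingElt o C h) {U V : Set C(Y, ℝ)} (hU : IsOpen U) (hV : IsOpen V)
    (hUh : attrFix o h ⊆ U) (hVh : repFix o h ⊆ V) :
    ∀ᶠ n : ℕ in atTop, ∀ ξ ∈ horoCpt Y o \ V, horoAct o (h ^ n) ξ ∈ U := by
  by_contra hcon
  obtain ⟨φ, hφ, hbad⟩ := extraction_of_frequently_atTop (not_eventually.1 hcon)
  push Not at hbad
  choose ξ hξ hξU using hbad
  let := TopologicalSpace.metrizableSpaceMetric C(Y, ℝ)
  have happrox : ∀ k, ∃ y : Y, dist (busemannCM o y) (ξ k) < 1 / ((k : ℝ) + 1) ∧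
      dist (busemannCM o (h ^ φ k • y)) (horoAct o (h ^ φ k) (ξ k)) < 1 / ((k : ℝ) + 1) := by
    intro k
    have hk : (0 : ℝ) < 1 / ((k : ℝ) + 1) := Nat.one_div_pos_of_nat
    have hnhds := inter_mem (Metric.ball_mem_nhds (ξ k) hk)
      ((continuous_horoAct o (h ^ φ k)).continuousAt.preimage_mem_nhds
        (Metric.ball_mem_nhds (horoAct o (h ^ φ k) (ξ k)) hk))
    obtain ⟨_, ⟨h1, h2⟩, y, rfl⟩ := mem_closure_iff_nhds.1 (hξ k).1 _ hnhds
    refine ⟨y, h1, ?_⟩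
    rw [← horoAct_busemannCM hiso]
    exact h2
  choose y hy hy' using happrox
  choose m hm using fun k => hh.projSet_nonempty (y k)
  have hlim : ∀ {u v : ℕ → C(Y, ℝ)} {σ : ℕ → ℕ} {ζ : C(Y, ℝ)}, Tendsto σ atTop atTop →
      (∀ k, dist (u k) (v k) < 1 / ((k : ℝ) + 1)) → Tendsto (v ∘ σ) atTop (𝓝 ζ) →
      Tendsto (u ∘ σ) atTop (𝓝 ζ) := by
    intro u v σ ζ hσ huv hv
    refine hv.congr_dist (squeeze_zero (fun _ => dist_nonneg) (fun k => ?_)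
      (tendsto_one_div_add_atTop_nhds_zero_nat.comp hσ))
    rw [dist_comm]
    exact (huv (σ k)).le
  by_cases hB : ∃ B : ℤ, ∃ᶠ k in atTop, B ≤ m k
  · obtain ⟨B, hB⟩ := hB
    obtain ⟨σ, hσ, hσB⟩ := extraction_of_frequently_atTop hB
    obtain ⟨η, -, τ, hτ, hη⟩ := (isCompact_horoCpt o).tendsto_subseq
      (x := fun k => horoAct o (h ^ φ (σ k)) (ξ (σ k)))
      fun k => horoAct_mem_horoCpt hiso o _ (hξ _).1
    have hηU : η ∉ U := hU.isClosed_compl.mem_of_tendsto hη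
      (Eventually.of_forall fun k => hξU _)
    have hconv : HoroConv o (fun k => h ^ φ (σ (τ k)) • y (σ (τ k))) η :=
      hlim (σ := σ ∘ τ) (hσ.comp hτ).tendsto_atTop hy' hη
    refine hηU (hUh (hh.mem_attrFix hY hC (m := fun k => φ (σ (τ k)) + m (σ (τ k)))
      (fun k => ?_) ?_ hconv))
    · simpa only [zpow_natCast] using
        zpow_add_smul_mem_projSet hiso (hm (σ (τ k))) (φ (σ (τ k)) : ℤ)
    · exact tendsto_atTop_add_right_of_le _ B
        (tendsto_natCast_atTop_atTop.comp (hφ.comp (hσ.comp hτ)).tendsto_atTop)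
        fun k => hσB _
  · push Not at hB
    obtain ⟨ζ, -, τ, hτ, hζ⟩ := (isCompact_horoCpt o).tendsto_subseq fun k => (hξ k).1
    have hζV : ζ ∉ V := hV.isClosed_compl.mem_of_tendsto hζ
      (Eventually.of_forall fun k => (hξ _).2)
    refine hζV (hVh (hh.mem_repFix hY hC (fun k => hm (τ k)) ?_
      (hlim hτ.tendsto_atTop hy hζ)))
    exact (tendsto_atBot.2 fun B => (hB B).mono fun k hk => hk.le).comp hτ.tendsto_atTop

end NorthSouth

/-- North–South dynamics of a contracting element on the horofunction
compactification: for any open `U ⊇ [h⁺]` and `V ⊇ [h⁻]` there is `n > 0` with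
`hⁿ(Ȳ \ V) ⊆ U` and `h⁻ⁿ(Ȳ \ U) ⊆ V`. -/
theorem statement9 {Y G : Type*} [MetricSpace Y] [ProperSpace Y]
    [Group G] [MulAction G Y] [Countable G] [ContinuousConstSMul G Y]
    (hY : GeodesicSpace Y) (hiso : IsometricAction G Y)
    (hprop : ProperAction G Y) (hne : NonElementary G) (o : Y)
    (h : G) (hh : IsContractingEltAny o h) :
    ∀ U V : Set C(Y, ℝ), IsOpen U → IsOpen V → attrFix o h ⊆ U → repFix o h ⊆ V →
      ∃ n : ℕ, 0 < n ∧
        (∀ ξ ∈ horoCpt Y o \ V, horoAct o (h ^ n) ξ ∈ U) ∧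
        (∀ ξ ∈ horoCpt Y o \ U, horoAct o (h ^ n)⁻¹ ξ ∈ V) := by
  intro U V hU hV hUh hVh
  obtain ⟨C, hC, hh⟩ := hh
  have hC0 : 0 ≤ C := by linarith
  have h1 := hh.eventually_horoAct_mem hY hiso hC0 hU hV hUh hVh
  have h2 := hh.inv.eventually_horoAct_mem hY hiso hC0 hV hU
    (by rwa [← repFix_eq_attrFix_inv]) (by rwa [repFix_eq_attrFix_inv, inv_inv])
  obtain ⟨n, hn, hn1, hn2⟩ := ((eventually_gt_atTop 0).and (h1.and h2)).exists
  exact ⟨n, hn, hn1, by simpa only [inv_pow] using hn2⟩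

end ConfDyn
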